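/- arXiv:1412.0113 — 2 statements merged into one kernel-verified Lean document; each statement's English description precedes it below -/
import Mathlib

section
/- Every R-tensor is a Q-tensor; that is, if A is an m-th order n-dimensional R-tensor, then for every q ∈ ℝⁿ the tensor complementarity problem (q, A) has a solution. -/
open Finset

/-- The $i$-th component of $\mathcal{A}x^{m-1}$ for an order-$(m+2)$, dimension-$n$ tensor. -/
def Axm1 {m n : ℕ} (A : (Fin (m + 2) → Fin n) → ℝ) (x : Fin n → ℝ) (i : Fin n) : ℝ :=
  ∑ f : Fin (m + 1) → Fin n, A (Fin.cons i f) * ∏ j, x (f j)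

/-- The homogeneous form $\mathcal{A}x^{m}$. -/
def Axm {m n : ℕ} (A : (Fin (m + 2) → Fin n) → ℝ) (x : Fin n → ℝ) : ℝ :=
  ∑ f : Fin (m + 2) → Fin n, A f * ∏ j, x (f j)

/-- `x` solves the tensor complementarity problem $(q, \mathcal{A})$. -/
def IsTCPSol {m n : ℕ} (A : (Fin (m + 2) → Fin n) → ℝ) (q x : Fin n → ℝ) : Prop :=
  (∀ i, 0 ≤ x i) ∧ (∀ i, 0 ≤ q i + Axm1 A x i) ∧ ∑ i, x i * (q i + Axm1 A x i) = 0

/-- Q-tensor: the TCP $(q,\mathcal{A})$ has a solution for every $q$. -/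
def QTensor {m n : ℕ} (A : (Fin (m + 2) → Fin n) → ℝ) : Prop :=
  ∀ q : Fin n → ℝ, ∃ x : Fin n → ℝ, IsTCPSol A q x

/-- R-tensor. -/
def RTensor {m n : ℕ} (A : (Fin (m + 2) → Fin n) → ℝ) : Prop :=
  ¬ ∃ (x : Fin n → ℝ) (t : ℝ), (∀ i, 0 ≤ x i) ∧ x ≠ 0 ∧ 0 ≤ t ∧
      (∀ i, 0 < x i → Axm1 A x i + t = 0) ∧ (∀ j, x j = 0 → 0 ≤ Axm1 A x j + t)

/-- R₀-tensor. -/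
def R0Tensor {m n : ℕ} (A : (Fin (m + 2) → Fin n) → ℝ) : Prop :=
  ¬ ∃ x : Fin n → ℝ, (∀ i, 0 ≤ x i) ∧ x ≠ 0 ∧
      (∀ i, 0 < x i → Axm1 A x i = 0) ∧ (∀ j, x j = 0 → 0 ≤ Axm1 A x j)

/-- Semi-positive tensor. -/
def SemiPositive {m n : ℕ} (A : (Fin (m + 2) → Fin n) → ℝ) : Prop :=
  ∀ x : Fin n → ℝ, (∀ i, 0 ≤ x i) → x ≠ 0 → ∃ k, 0 < x k ∧ 0 ≤ Axm1 A x k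

/-- Strictly semi-positive tensor. -/
def StrictlySemiPositive {m n : ℕ} (A : (Fin (m + 2) → Fin n) → ℝ) : Prop :=
  ∀ x : Fin n → ℝ, (∀ i, 0 ≤ x i) → x ≠ 0 → ∃ k, 0 < x k ∧ 0 < Axm1 A x k

/-- P-tensor. -/
def PTensor {m n : ℕ} (A : (Fin (m + 2) → Fin n) → ℝ) : Prop :=
  ∀ x : Fin n → ℝ, x ≠ 0 → ∃ i, 0 < x i * Axm1 A x i

/-- Symmetric tensor: entries invariant under permutation of indices. -/
def SymTensor {m n : ℕ} (A : (Fin (m + 2) → Fin n) → ℝ) : Prop :=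
  ∀ (f : Fin (m + 2) → Fin n) (σ : Equiv.Perm (Fin (m + 2))), A (f ∘ σ) = A f

/-- Copositive tensor. -/
def Copositive {m n : ℕ} (A : (Fin (m + 2) → Fin n) → ℝ) : Prop :=
  ∀ x : Fin n → ℝ, (∀ i, 0 ≤ x i) → 0 ≤ Axm A x

/-- Strictly copositive tensor. -/
def StrictlyCopositive {m n : ℕ} (A : (Fin (m + 2) → Fin n) → ℝ) : Prop :=
  ∀ x : Fin n → ℝ, (∀ i, 0 ≤ x i) → x ≠ 0 → 0 < Axm A x

section Brouwer

open MeasureTheory Metric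

variable {E : Type*} [NormedAddCommGroup E] [InnerProductSpace ℝ E] [FiniteDimensional ℝ E]

lemma det_lagrange (t₀ : ℝ) (ht₀ : 0 < t₀) (d : ℕ) (hd : Module.finrank ℝ E = d) :
    ∃ (t c : Fin (d + 1) → ℝ), (∀ j, 0 ≤ t j ∧ t j < t₀) ∧ ∑ j, c j = 1 ∧
      ∀ M : E →L[ℝ] E, (1 + M).det = ∑ j, c j * (1 + t j • M).det := by
  classical
  let v : Fin (d + 1) → ℝ := fun j => t₀ * (j : ℕ) / (d + 1)
  have hv : Set.InjOn v (Finset.univ : Finset (Fin (d + 1))) := by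
    intro i _ j _ hij
    have h1 : (0 : ℝ) < d + 1 := by positivity
    simp only [v] at hij
    field_simp at hij
    exact Fin.ext (by exact_mod_cast hij)
  refine ⟨v, fun j => (Lagrange.basis Finset.univ v j).eval 1, ?_, ?_, ?_⟩
  · intro j
    refine ⟨by positivity, ?_⟩
    have h1 : (0 : ℝ) < d + 1 := by positivity
    have h2 : ((j : ℕ) : ℝ) < d + 1 := by exact_mod_cast j.2
    simp only [v]
    rw [div_lt_iff₀ h1]
    exact mul_lt_mul_of_pos_left h2 ht₀
  · have := Lagrange.sum_basis hv ⟨0, Finset.mem_univ _⟩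
    have := congrArg (Polynomial.eval 1) this
    simpa [Polynomial.eval_finsetSum] using this
  · intro M
    let b := Module.finBasisOfFinrankEq ℝ E hd
    let A := LinearMap.toMatrix b b (M : E →ₗ[ℝ] E)
    let Q : Polynomial ℝ :=
      Matrix.det ((Polynomial.X : Polynomial ℝ) • A.map Polynomial.C + (1 : Matrix _ _ ℝ).map Polynomial.C)
    have hQ : ∀ s : ℝ, Q.eval s = (1 + s • M).det := by
      intro s
      have e1 : Q.eval s = (s • A + 1).det := by
        simp only [Q]
        rw [← Polynomial.coe_evalRingHom, RingHom.map_det]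
        congr 1
        ext i j
        simp [Matrix.one_apply]
        split_ifs <;> simp [mul_comm]
      rw [e1, ContinuousLinearMap.det, ← LinearMap.det_toMatrix b]
      congr 1
      have : ((1 + s • M : E →L[ℝ] E) : E →ₗ[ℝ] E) = LinearMap.id + s • (M : E →ₗ[ℝ] E) := by
        ext; simp
      rw [this, map_add, map_smul, LinearMap.toMatrix_id, add_comm]
    have hdeg : Q.degree < (Finset.univ : Finset (Fin (d + 1))).card := by
      have := Polynomial.natDegree_det_X_add_C_le A 1
      simp only [Fintype.card_fin] at this
      rw [Finset.card_fin]
      refine lt_of_le_of_lt Polynomial.degree_le_natDegree ?_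
      exact_mod_cast Nat.lt_succ_of_le this
    have h1 := congrArg (Polynomial.eval 1) (Lagrange.eq_interpolate hv hdeg)
    rw [hQ, one_smul] at h1
    rw [h1, Lagrange.interpolate_apply, Polynomial.eval_finsetSum]
    refine Finset.sum_congr rfl fun j _ => ?_
    simp [hQ, mul_comm]

lemma det_pos_of_small (M : E →L[ℝ] E) (K t : ℝ) (ht : 0 ≤ t) (hM : ‖M‖ ≤ K) (h : t * K < 1) :
    0 < (1 + t • M).det := by
  have hne : ∀ s ∈ Set.Icc 0 t, (1 + s • M).det ≠ 0 := by
    intro s hs h0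
    have : ¬ Function.Injective ((1 + s • M : E →L[ℝ] E) : E →ₗ[ℝ] E) := by
      intro hi
      have := LinearMap.isUnit_iff_ker_eq_bot _ |>.2 (LinearMap.ker_eq_bot.2 hi)
      have := this.map LinearMap.det
      exact this.ne_zero h0
    apply this
    rw [← LinearMap.ker_eq_bot, LinearMap.ker_eq_bot']
    intro v hv
    have hv' : v + s • M v = 0 := by simpa using hv
    have h1 : ‖v‖ = s * ‖M v‖ := by
      calc ‖v‖ = ‖-(s • M v)‖ := congrArg _ (eq_neg_of_add_eq_zero_left hv')
        _ = s * ‖M v‖ := by rw [norm_neg, norm_smul, Real.norm_of_nonneg hs.1]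
    by_contra hv0
    have hvp : 0 < ‖v‖ := norm_pos_iff.2 hv0
    have h2 : ‖M v‖ ≤ K * ‖v‖ := (M.le_opNorm v).trans (by gcongr)
    have hK : 0 ≤ K := (norm_nonneg _).trans hM
    have h3 : s * ‖M v‖ ≤ t * (K * ‖v‖) := mul_le_mul hs.2 h2 (norm_nonneg _) ht
    nlinarith
  by_contra hneg
  push Not at hneg
  have hc : ContinuousOn (fun s : ℝ => (1 + s • M).det) (Set.Icc 0 t) := by
    apply Continuous.continuousOn
    exact ContinuousLinearMap.continuous_det.comp (by fun_prop)
  have := intermediate_value_Icc' ht hc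
  have h0 : (1 + (0:ℝ) • M).det = 1 := by
    simp [ContinuousLinearMap.det]
  obtain ⟨s, hs, hs0⟩ := this ⟨hneg, by rw [h0]; exact zero_le_one⟩
  exact hne s hs hs0

lemma no_retraction [MeasurableSpace E] [BorelSpace E] (h : E → E) (K : NNReal)
    (hK : LipschitzWith K h) (ρ : ℝ) (hρ : 0 < ρ)
    (hout : ∀ x, ρ ≤ ‖x‖ → h x = 0) (hin : ∀ x, ‖x‖ < ρ → ‖x + h x‖ = ρ) : False := by
  let μ : Measure E := μH[Module.finrank ℝ E]
  let B : Set E := ball 0 ρ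
  let S : Set E := B ∩ {x | DifferentiableAt ℝ h x}
  have hS : MeasurableSet S := isOpen_ball.measurableSet.inter (measurableSet_of_differentiableAt ℝ h)
  have hnull : μ (B \ S) = 0 := by
    have := hK.ae_differentiableAt (μ := μ)
    refine measure_mono_null ?_ this
    intro x hx hx'
    exact hx.2 ⟨hx.1, hx'⟩
  have hBpos : 0 < μ.real B := by
    rw [Measure.real, ENNReal.toReal_pos_iff]
    exact ⟨measure_ball_pos _ _ hρ, measure_ball_lt_top⟩
  have hKp : (0 : ℝ) < 1 / (K + 1) := by positivity
  have key : ∀ t : ℝ, 0 ≤ t → t < 1 / (K + 1) →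
      IntegrableOn (fun x => (1 + t • fderiv ℝ h x).det) S μ ∧
      ∫ x in S, (1 + t • fderiv ℝ h x).det ∂μ = μ.real B := by
    intro t ht ht1
    have htK : t * K < 1 := by
      rw [lt_div_iff₀ (by positivity)] at ht1
      nlinarith
    let g : E → E := fun x => x + t • h x
    have hdist : ∀ x y, ‖h x - h y‖ ≤ K * ‖x - y‖ := fun x y => by
      simpa [dist_eq_norm] using hK.dist_le_mul x y
    have hLip : ∀ x y, ‖t • h x - t • h y‖ ≤ t * K * ‖x - y‖ := fun x y => by
      rw [← smul_sub, norm_smul, Real.norm_of_nonneg ht, mul_assoc]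
      exact mul_le_mul_of_nonneg_left (hdist x y) ht
    have hinj : Function.Injective g := by
      intro x y hxy
      have h1 : x - y = t • h y - t • h x := by
        have : x + t • h x = y + t • h y := hxy
        rw [sub_eq_sub_iff_add_eq_add, this, add_comm]
      have h2 := hLip y x
      rw [← h1, norm_sub_rev y x] at h2
      by_contra hne
      have : 0 < ‖x - y‖ := norm_pos_iff.2 (sub_ne_zero.2 hne)
      nlinarith
    have hsurj : Function.Surjective g := by
      intro y
      have hc : ContractingWith ⟨t * K, by positivity⟩ (fun x => y - t • h x) := by
        refine ⟨by exact_mod_cast htK, LipschitzWith.of_dist_le_mul fun a b => ?_⟩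
        rw [dist_eq_norm, dist_eq_norm, sub_sub_sub_cancel_left, norm_sub_rev a b]
        exact hLip b a
      refine ⟨hc.fixedPoint, ?_⟩
      have := hc.fixedPoint_isFixedPt
      have h2 : y - t • h hc.fixedPoint = hc.fixedPoint := this
      exact (sub_eq_iff_eq_add.1 h2).symm
    have himg : g '' B = B := by
      have hid : ∀ x, x ∉ B → g x = x := by
        intro x hx
        have : ρ ≤ ‖x‖ := by simpa [B] using hx
        simp [g, hout x this]
      ext y
      constructor
      · rintro ⟨x, hx, rfl⟩
        by_contra hg
        have := hinj (hid _ hg)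
        rw [this] at hg
        exact hg hx
      · intro hy
        obtain ⟨x, rfl⟩ := hsurj y
        by_cases hx : x ∈ B
        · exact ⟨x, hx, rfl⟩
        · rw [hid x hx] at hy
          exact absurd hy hx
    have hgL : LipschitzWith (1 + ⟨t * K, by positivity⟩) g := by
      apply LipschitzWith.add LipschitzWith.id
      exact LipschitzWith.of_dist_le_mul fun a b => by
        rw [dist_eq_norm, dist_eq_norm]; exact hLip a b
    have himgN : μ (g '' (B \ S)) = 0 := by
      have := hgL.hausdorffMeasure_image_le (d := Module.finrank ℝ E) (by positivity) (B \ S)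
      rw [show μH[(Module.finrank ℝ E : ℝ)] (B \ S) = 0 from hnull, mul_zero] at this
      exact le_antisymm this bot_le
    have hgS : μ.real (g '' S) = μ.real B := by
      have : B = g '' S ∪ g '' (B \ S) := by
        rw [← Set.image_union, Set.union_sdiff_cancel Set.inter_subset_left, himg]
      have h2 : μ B = μ (g '' S) := by
        conv_lhs => rw [this]
        refine le_antisymm ((measure_union_le _ _).trans ?_) (measure_mono Set.subset_union_left)
        rw [himgN, add_zero]
      rw [Measure.real, Measure.real, h2]
    have hder : ∀ x ∈ S, HasFDerivWithinAt g (1 + t • fderiv ℝ h x) S x := by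
      intro x hx
      have : HasFDerivAt h (fderiv ℝ h x) x := hx.2.hasFDerivAt
      exact ((hasFDerivAt_id x).add (this.const_smul t)).hasFDerivWithinAt
    have hpos : ∀ x, |(1 + t • fderiv ℝ h x).det| = (1 + t • fderiv ℝ h x).det := fun x =>
      abs_of_pos (det_pos_of_small _ K t ht (norm_fderiv_le_of_lipschitz ℝ hK) htK)
    constructor
    · have := (integrableOn_image_iff_integrableOn_abs_det_fderiv_smul μ hS hder hinj.injOn
        (fun _ => (1 : ℝ))).1 (by
          apply integrableOn_const (hs := ?_)
          refine ne_top_of_le_ne_top (measure_ball_lt_top (μ := μ) (x := 0) (r := ρ)).ne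
            (measure_mono ?_)
          calc g '' S ⊆ g '' B := Set.image_mono Set.inter_subset_left
            _ = B := himg)
      simpa [hpos] using this
    · have := integral_image_eq_integral_abs_det_fderiv_smul μ hS hder hinj.injOn
        (fun _ => (1 : ℝ))
      simp only [hpos, smul_eq_mul, mul_one, setIntegral_const] at this
      rw [← this, hgS]
  obtain ⟨t, c, htc, hc1, hdet⟩ := det_lagrange (E := E) _ hKp _ rfl
  have hzero : ∀ x ∈ S, (1 + fderiv ℝ h x).det = 0 := by
    intro x hx
    have hd : HasFDerivAt (fun y => y + h y) (1 + fderiv ℝ h x) x :=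
      (hasFDerivAt_id x).add hx.2.hasFDerivAt
    have hn := hd.norm_sq
    have hconst : HasFDerivAt (fun y => ‖y + h y‖ ^ 2) (0 : E →L[ℝ] ℝ) x := by
      refine (hasFDerivAt_const (ρ ^ 2) x).congr_of_eventuallyEq ?_
      filter_upwards [isOpen_ball.mem_nhds hx.1] with y hy
      rw [hin y (by simpa [B] using hy)]
    have he := hn.unique hconst
    by_contra hne
    have hu : IsUnit ((1 + fderiv ℝ h x : E →L[ℝ] E) : E →ₗ[ℝ] E) := by
      exact (LinearMap.isUnit_iff_isUnit_det _).2 (isUnit_iff_ne_zero.2 hne)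
    have hs : Function.Surjective ((1 + fderiv ℝ h x : E →L[ℝ] E) : E →ₗ[ℝ] E) := by
      exact LinearMap.range_eq_top.1 ((LinearMap.isUnit_iff_range_eq_top _).1 hu)
    obtain ⟨v, hv⟩ := hs (x + h x)
    have h3 : (2 • (innerSL ℝ (x + h x)).comp (1 + fderiv ℝ h x)) v = (0 : E →L[ℝ] ℝ) v := by
      rw [he]
    have hv' : (1 + fderiv ℝ h x) v = x + h x := hv
    have hnx := hin x (by simpa [B] using hx.1)
    have h4 : (2 : ℕ) • inner ℝ (x + h x) ((1 + fderiv ℝ h x) v) = (0 : ℝ) := h3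
    rw [hv', real_inner_self_eq_norm_sq, hnx] at h4
    have : 0 < ρ ^ 2 := by positivity
    simp at h4
    exact hρ.ne' h4
  have e1 : ∫ x in S, (1 + fderiv ℝ h x).det ∂μ = 0 := by
    rw [setIntegral_congr_fun hS hzero]; simp
  have e2 : ∫ x in S, (1 + fderiv ℝ h x).det ∂μ = μ.real B := by
    rw [setIntegral_congr_fun hS fun x _ => hdet (fderiv ℝ h x)]
    rw [integral_finsetSum]
    · simp_rw [integral_const_mul]
      rw [Finset.sum_congr rfl fun j _ => by rw [(key (t j) (htc j).1 (htc j).2).2],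
        ← Finset.sum_mul, hc1, one_mul]
    · intro j _
      exact (key (t j) (htc j).1 (htc j).2).1.const_mul _
  rw [e1] at e2
  exact hBpos.ne e2

end Brouwer

section Fixed

open Metric

lemma lipschitz_smul_aux {E F : Type*} [NormedAddCommGroup E] [NormedAddCommGroup F]
    [NormedSpace ℝ F] (a : E → ℝ) (v : E → F) (K L : NNReal) (C R : ℝ) (hC : 0 ≤ C) (hR : 0 ≤ R)
    (ha : LipschitzWith K a) (hv : LipschitzWith L v) (haC : ∀ x, |a x| ≤ C)
    (hvR : ∀ x, ‖v x‖ ≤ R ∨ a x = 0) :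
    ∃ M : NNReal, LipschitzWith M (fun x => a x • v x) := by
  refine ⟨⟨C * L + K * R, by positivity⟩, LipschitzWith.of_dist_le_mul ?_⟩
  have ha' : ∀ x y, |a x - a y| ≤ K * ‖x - y‖ := fun x y => by
    simpa [dist_eq_norm] using ha.dist_le_mul x y
  have hv' : ∀ x y, ‖v x - v y‖ ≤ L * ‖x - y‖ := fun x y => by
    simpa [dist_eq_norm] using hv.dist_le_mul x y
  have main : ∀ x y, ‖v y‖ ≤ R → ‖a x • v x - a y • v y‖ ≤ (C * L + K * R) * ‖x - y‖ := by
    intro x y hy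
    have e : a x • v x - a y • v y = a x • (v x - v y) + (a x - a y) • v y := by
      rw [smul_sub, sub_smul]; abel
    rw [e]
    refine (norm_add_le _ _).trans ?_
    rw [norm_smul, norm_smul, Real.norm_eq_abs, Real.norm_eq_abs]
    have h1 : |a x| * ‖v x - v y‖ ≤ C * (L * ‖x - y‖) :=
      mul_le_mul (haC x) (hv' x y) (norm_nonneg _) hC
    have h2 : |a x - a y| * ‖v y‖ ≤ (K * ‖x - y‖) * R :=
      mul_le_mul (ha' x y) hy (norm_nonneg _) (by positivity)
    linarith
  intro x y
  rw [dist_eq_norm, dist_eq_norm]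
  change _ ≤ (C * L + K * R) * ‖x - y‖
  rcases hvR y with hy | hy
  · exact main x y hy
  rcases hvR x with hx | hx
  · rw [norm_sub_rev, norm_sub_rev x y]
    exact main y x hx
  · simp only [hx, hy, zero_smul, sub_zero, norm_zero]
    positivity

lemma fixed_point_euclid {E : Type*} [NormedAddCommGroup E] [InnerProductSpace ℝ E]
    [FiniteDimensional ℝ E] (f : E → E) (L : NNReal) (hf : LipschitzWith L f)
    (R : ℝ) (hR : 0 < R) (hfR : ∀ x, ‖f x‖ ≤ R) : ∃ x, f x = x := by
  let _ : MeasurableSpace E := borel E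
  have _ : BorelSpace E := ⟨rfl⟩
  by_contra hno
  push Not at hno
  -- the cutoff
  let χ : E → ℝ := fun x => max 0 (min 1 (2 - R⁻¹ * ‖x‖))
  have hχL : ∃ K, LipschitzWith K χ := by
    have h1 : LipschitzWith (‖R⁻¹‖₊ * 1) (fun x : E => R⁻¹ * ‖x‖) :=
      (lipschitzWith_smul R⁻¹).comp lipschitzWith_one_norm
    have h2 : LipschitzWith (0 + ‖R⁻¹‖₊ * 1) (fun x : E => 2 - R⁻¹ * ‖x‖) :=
      (LipschitzWith.const 2).sub h1
    exact ⟨_, (h2.const_min 1).const_max 0⟩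
  obtain ⟨Kχ, hχL⟩ := hχL
  have hχ0 : ∀ x, 0 ≤ χ x := fun x => le_max_left _ _
  have hχ1 : ∀ x, χ x ≤ 1 := fun x => max_le zero_le_one (min_le_left _ _)
  have hχin : ∀ x, ‖x‖ ≤ R → χ x = 1 := by
    intro x hx
    have : R⁻¹ * ‖x‖ ≤ 1 := by
      rw [inv_mul_le_iff₀ hR]; linarith
    simp only [χ]
    rw [min_eq_left (by linarith), max_eq_right zero_le_one]
  have hχout : ∀ x, 2 * R ≤ ‖x‖ → χ x = 0 := by
    intro x hx
    have : 2 ≤ R⁻¹ * ‖x‖ := by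
      rw [le_inv_mul_iff₀ hR]; linarith
    simp only [χ]
    rw [max_eq_left]
    exact (min_le_right _ _).trans (by linarith)
  obtain ⟨Kk, hk⟩ := lipschitz_smul_aux χ f Kχ L 1 R zero_le_one hR.le hχL hf
    (fun x => by rw [abs_of_nonneg (hχ0 x)]; exact hχ1 x) (fun x => Or.inl (hfR x))
  let k : E → E := fun x => χ x • f x
  have hkR : ∀ x, ‖k x‖ ≤ R := fun x => by
    simp only [k]
    rw [norm_smul, Real.norm_of_nonneg (hχ0 x)]
    nlinarith [hχ0 x, hχ1 x, hfR x, norm_nonneg (f x)]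
  let g : E → E := fun x => x - k x
  have hgL : LipschitzWith (1 + Kk) g := LipschitzWith.id.sub hk
  have hgne : ∀ x, g x ≠ 0 := by
    intro x hx
    have hxk : x = k x := sub_eq_zero.1 hx
    have : ‖x‖ ≤ R := by rw [hxk]; exact hkR x
    apply hno x
    have h1 : k x = f x := by simp [k, hχin x this]
    rw [← h1]; exact hxk.symm
  have hgout : ∀ x, 2 * R ≤ ‖x‖ → g x = x := fun x hx => by
    simp [g, k, hχout x hx]
  obtain ⟨ε, hε, hgε⟩ : ∃ ε > 0, ∀ x, ε ≤ ‖g x‖ := by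
    obtain ⟨x₀, -, hx₀⟩ := (isCompact_closedBall (0 : E) (2 * R)).exists_isMinOn
      ⟨0, by simp [hR.le]⟩ (hgL.continuous.norm.continuousOn)
    refine ⟨min ‖g x₀‖ (2 * R), lt_min (norm_pos_iff.2 (hgne x₀)) (by positivity), fun x => ?_⟩
    by_cases hx : ‖x‖ ≤ 2 * R
    · exact (min_le_left _ _).trans (hx₀ (by simpa using hx))
    · push Not at hx
      rw [hgout x hx.le]
      exact (min_le_right _ _).trans hx.le
  let ρ := 3 * R
  have hρ : 0 < ρ := by positivity
  let a : E → ℝ := fun z => max 0 (ρ / max ε ‖z‖ - 1)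
  have hmax : ∀ z : E, ε ≤ max ε ‖z‖ := fun z => le_max_left _ _
  have hmax0 : ∀ z : E, 0 < max ε ‖z‖ := fun z => hε.trans_le (hmax z)
  have haL : ∃ K, LipschitzWith K a := by
    have h1 : LipschitzWith 1 (fun z : E => max ε ‖z‖) := lipschitzWith_one_norm.const_max ε
    have h2 : LipschitzWith ⟨ρ / ε ^ 2, by positivity⟩ (fun z : E => ρ / max ε ‖z‖) := by
      refine LipschitzWith.of_dist_le_mul fun z w => ?_
      have h3 := h1.dist_le_mul z w
      rw [Real.dist_eq] at h3 ⊢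
      change _ ≤ ρ / ε ^ 2 * dist z w
      have hz := hmax0 z
      have hw := hmax0 w
      rw [div_sub_div _ _ hz.ne' hw.ne', mul_comm (max ε ‖z‖) ρ, ← mul_sub, abs_div, abs_mul,
        abs_of_pos hρ, abs_of_pos (mul_pos hz hw), abs_sub_comm, mul_div_right_comm]
      simp only [NNReal.coe_one, one_mul] at h3
      refine mul_le_mul ?_ h3 (abs_nonneg _) (by positivity)
      apply div_le_div_of_nonneg_left hρ.le (by positivity)
      rw [sq]
      exact mul_le_mul (hmax z) (hmax w) hε.le hz.le
    exact ⟨_, (h2.sub (LipschitzWith.const 1)).const_max 0⟩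
  obtain ⟨Ka, haL⟩ := haL
  have ha0 : ∀ z, 0 ≤ a z := fun z => le_max_left _ _
  have haC : ∀ z, |a z| ≤ ρ / ε := by
    intro z
    rw [abs_of_nonneg (ha0 z)]
    refine max_le (by positivity) ?_
    have : ρ / max ε ‖z‖ ≤ ρ / ε := div_le_div_of_nonneg_left hρ.le hε (hmax z)
    linarith
  have haout : ∀ z, ρ ≤ ‖z‖ → a z = 0 := by
    intro z hz
    refine max_eq_left ?_
    have : ρ / max ε ‖z‖ ≤ 1 := (div_le_one (hmax0 z)).2 (hz.trans (le_max_right _ _))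
    linarith
  obtain ⟨Kp, hp⟩ := lipschitz_smul_aux a (fun z : E => z) Ka 1 (ρ / ε) ρ (by positivity) hρ.le
    haL LipschitzWith.id haC (fun z => by
      rcases le_total ‖z‖ ρ with h | h
      · exact Or.inl h
      · exact Or.inr (haout z h))
  have hh : LipschitzWith (Kp * (1 + Kk) + Kk) (fun x => a (g x) • g x - k x) :=
    (hp.comp hgL).sub hk
  refine no_retraction _ _ hh ρ hρ ?_ ?_
  · intro x hx
    have hx2 : 2 * R ≤ ‖x‖ := by simp only [ρ] at hx; linarith
    have : k x = 0 := by simp [k, hχout x hx2]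
    rw [hgout x hx2, haout x hx, this]
    simp
  · intro x hx
    have hgx : ‖g x‖ ≤ ρ := by
      rcases le_total ‖x‖ (2 * R) with h | h
      · have := norm_sub_le x (k x)
        have := hkR x
        simp only [g, ρ]
        linarith
      · rw [hgout x h]; exact hx.le
    have hg0 : 0 < ‖g x‖ := hε.trans_le (hgε x)
    have hax : a (g x) = ρ / ‖g x‖ - 1 := by
      simp only [a]
      rw [max_eq_right (hgε x)]
      refine max_eq_right ?_
      have : 1 ≤ ρ / ‖g x‖ := (one_le_div hg0).2 hgx
      linarith
    have e : x + (a (g x) • g x - k x) = (ρ / ‖g x‖) • g x := by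
      rw [hax, sub_smul, one_smul]
      simp only [g]; abel
    rw [e, norm_smul, Real.norm_of_nonneg (by positivity)]
    field_simp

/-- Variational inequality on a box. -/
lemma box_vi {ι : Type*} [Fintype ι] (G : (ι → ℝ) → ι → ℝ) (hG : ContDiff ℝ 1 G)
    (b : ι → ℝ) (hb : ∀ i, 0 < b i) :
    ∃ x : ι → ℝ, ∀ i, 0 ≤ x i ∧ x i ≤ b i ∧ (0 < x i → G x i ≤ 0) ∧ (x i < b i → 0 ≤ G x i) := by
  let cl : (ι → ℝ) → ι → ℝ := fun x i => max 0 (min (b i) (x i))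
  have hclL : LipschitzWith 1 cl := by
    refine LipschitzWith.of_dist_le_mul fun x y => ?_
    rw [NNReal.coe_one, one_mul, dist_pi_le_iff dist_nonneg]
    intro i
    have h := ((LipschitzWith.id (α := ℝ)).const_min (b i)).const_max 0
    have := h.dist_le_mul (x i) (y i)
    simp only [NNReal.coe_one, one_mul] at this
    exact this.trans (dist_le_pi_dist x y i)
  have hclmem : ∀ x, cl x ∈ Set.Icc 0 b := fun x =>
    ⟨fun i => le_max_left _ _, fun i => max_le (hb i).le (min_le_left _ _)⟩
  obtain ⟨KG, hKG⟩ : ∃ K, LipschitzOnWith K G (Set.Icc 0 b) :=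
    hG.contDiffOn.exists_lipschitzOnWith one_ne_zero (convex_Icc _ _) isCompact_Icc
  have hGcl : LipschitzWith (KG * 1) (fun x => G (cl x)) := by
    rw [← lipschitzOnWith_univ]
    exact hKG.comp hclL.lipschitzOnWith (fun x _ => hclmem x)
  have hF : LipschitzWith (1 * (1 + KG * 1)) (fun x => cl (cl x - G (cl x))) :=
    hclL.comp (hclL.sub hGcl)
  let e := EuclideanSpace.equiv ι ℝ
  let f : EuclideanSpace ℝ ι → EuclideanSpace ℝ ι :=
    fun z => e.symm (cl (cl (e z) - G (cl (e z))))
  have hfL := (e.symm.lipschitz.comp hF).comp e.lipschitz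
  obtain ⟨C, hC⟩ : ∃ C, ∀ y ∈ Set.Icc (0 : ι → ℝ) b, ‖e.symm y‖ ≤ C :=
    isCompact_Icc.exists_bound_of_continuousOn e.symm.continuous.continuousOn
  obtain ⟨z, hz⟩ := fixed_point_euclid f _ hfL (max C 1) (by positivity)
    (fun x => (hC _ (hclmem _)).trans (le_max_left _ _))
  have hx : cl (cl (e z) - G (cl (e z))) = e z := by
    have := congrArg e hz
    simpa only [f, ContinuousLinearEquiv.apply_symm_apply] using this
  generalize e z = x at hx
  have hxm : x ∈ Set.Icc 0 b := by rw [← hx]; exact hclmem _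
  have hcx : cl x = x := by
    ext i
    have h1 : 0 ≤ x i := hxm.1 i
    have h2 := hxm.2 i
    simp only [cl]
    rw [min_eq_right h2, max_eq_right h1]
  rw [hcx] at hx
  refine ⟨x, fun i => ?_⟩
  have hi : max 0 (min (b i) (x i - G x i)) = x i := congrFun hx i
  refine ⟨hxm.1 i, hxm.2 i, fun h => ?_, fun h => ?_⟩
  · by_contra hc
    push Not at hc
    have : max 0 (min (b i) (x i - G x i)) < x i :=
      max_lt h ((min_le_right _ _).trans_lt (by linarith))
    linarith
  · by_contra hc
    push Not at hc
    have : x i < max 0 (min (b i) (x i - G x i)) :=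
      lt_max_of_lt_right (lt_min h (by linarith))
    linarith

end Fixed

lemma Axm1_contDiff {m n : ℕ} (A : (Fin (m + 2) → Fin n) → ℝ) (i : Fin n) :
    ContDiff ℝ 1 (fun x => Axm1 A x i) := by
  unfold Axm1
  refine ContDiff.sum fun f _ => contDiff_const.mul (contDiff_prod fun j _ => ?_)
  exact contDiff_apply ℝ ℝ (f j)

lemma Axm1_smul {m n : ℕ} (A : (Fin (m + 2) → Fin n) → ℝ) (i : Fin n) (r : ℝ) (x : Fin n → ℝ) :
    Axm1 A (r • x) i = r ^ (m + 1) * Axm1 A x i := by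
  unfold Axm1
  rw [Finset.mul_sum]
  refine Finset.sum_congr rfl fun f _ => ?_
  simp only [Pi.smul_apply, smul_eq_mul, Finset.prod_mul_distrib, Finset.prod_const,
    Finset.card_univ, Fintype.card_fin]
  ring

/-- Truncated complementarity problem. -/
lemma truncated {m n : ℕ} (A : (Fin (m + 2) → Fin n) → ℝ) (q : Fin n → ℝ) (r : ℝ) (hr : 0 < r) :
    ∃ (x : Fin n → ℝ) (t : ℝ), (∀ i, 0 ≤ x i) ∧ 0 ≤ t ∧ (∀ i, 0 ≤ q i + Axm1 A x i + t) ∧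
      (∀ i, 0 < x i → q i + Axm1 A x i + t = 0) ∧ (0 < t → ∑ i, x i = r) := by
  have hcd : ∀ i, ContDiff ℝ 1 (fun x => Axm1 A x i) := Axm1_contDiff A
  obtain ⟨T, hT⟩ : ∃ T, ∀ x ∈ Set.Icc (0 : Fin n → ℝ) (fun _ => r + 1),
      ‖(fun i => q i + Axm1 A x i : Fin n → ℝ)‖ ≤ T :=
    isCompact_Icc.exists_bound_of_continuousOn
      (continuous_pi fun i => continuous_const.add (hcd i).continuous).continuousOn
  let G : (Option (Fin n) → ℝ) → Option (Fin n) → ℝ := fun z o =>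
    o.elim (r - ∑ i, z (some i)) (fun i => q i + Axm1 A (fun j => z (some j)) i + z none)
  have hG : ContDiff ℝ 1 G := by
    rw [contDiff_pi]
    have hz : ∀ o, ContDiff ℝ 1 (fun z : Option (Fin n) → ℝ => z o) := contDiff_apply ℝ ℝ
    rintro (_ | i)
    · exact contDiff_const.sub (ContDiff.sum fun i _ => hz (some i))
    · have hp : ContDiff ℝ 1 (fun z : Option (Fin n) → ℝ => fun j => z (some j)) :=
        contDiff_pi.2 fun j => hz (some j)
      exact (contDiff_const.add ((hcd i).comp hp)).add (hz none)
  let T' := max T 0 + 1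
  have hT' : 0 < T' := by positivity
  obtain ⟨z, hz⟩ := box_vi G hG (fun o => o.elim T' (fun _ => r + 1)) (by
    rintro (_ | i)
    · exact hT'
    · show 0 < r + 1
      linarith)
  have hsome : ∀ i, 0 ≤ z (some i) ∧ z (some i) ≤ r + 1 ∧
      (0 < z (some i) → q i + Axm1 A (fun j => z (some j)) i + z none ≤ 0) ∧
      (z (some i) < r + 1 → 0 ≤ q i + Axm1 A (fun j => z (some j)) i + z none) :=
    fun i => hz (some i)
  have hnone : 0 ≤ z none ∧ z none ≤ T' ∧ (0 < z none → r - ∑ i, z (some i) ≤ 0) ∧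
      (z none < T' → 0 ≤ r - ∑ i, z (some i)) := hz none
  generalize z none = t at hsome hnone
  obtain ⟨x, hx⟩ : ∃ x : Fin n → ℝ, x = fun j => z (some j) := ⟨_, rfl⟩
  have hxi : ∀ i, z (some i) = x i := fun i => by rw [hx]
  simp only [← hx, hxi] at hsome hnone
  have htlt : t < T' := by
    by_contra hge
    push Not at hge
    have hs := hnone.2.2.1 (hT'.trans_le hge)
    obtain ⟨i, -, hi⟩ : ∃ i ∈ Finset.univ, 0 < x i := by
      by_contra hcon
      push Not at hcon
      have := Finset.sum_nonpos hcon
      linarith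
    have h1 := (hsome i).2.2.1 hi
    have h2 := hT x ⟨fun j => (hsome j).1, fun j => (hsome j).2.1⟩
    have h3 := (norm_le_pi_norm (fun i => q i + Axm1 A x i : Fin n → ℝ) i).trans h2
    have h4 := (abs_le.1 h3).1
    have h5 : T ≤ max T 0 := le_max_left _ _
    have h6 : T' = max T 0 + 1 := rfl
    linarith
  have hsum := hnone.2.2.2 htlt
  have hxle : ∀ i, x i < r + 1 := by
    intro i
    have := Finset.single_le_sum (f := x) (fun j _ => (hsome j).1) (Finset.mem_univ i)
    linarith
  refine ⟨x, t, fun i => (hsome i).1, hnone.1, fun i => (hsome i).2.2.2 (hxle i), fun i hi => ?_,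
    fun ht => ?_⟩
  · exact le_antisymm ((hsome i).2.2.1 hi) ((hsome i).2.2.2 (hxle i))
  · have := hnone.2.2.1 ht
    linarith

theorem stmt2 {m n : ℕ} (A : (Fin (m + 2) → Fin n) → ℝ) (hA : RTensor A) :
    QTensor A := by
  intro q
  by_contra hno
  have step : ∀ k : ℕ, ∃ (y : Fin n → ℝ) (s : ℝ), (∀ i, 0 ≤ y i) ∧ ∑ i, y i = 1 ∧ 0 ≤ s ∧
      (∀ i, 0 ≤ q i * (1 / ((k : ℝ) + 1)) ^ (m + 1) + Axm1 A y i + s) ∧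
      (∀ i, y i * (q i * (1 / ((k : ℝ) + 1)) ^ (m + 1) + Axm1 A y i + s) = 0) := by
    intro k
    have hr : (0 : ℝ) < (k : ℝ) + 1 := by positivity
    generalize (k : ℝ) + 1 = r at hr
    obtain ⟨x, t, hx, ht, hge, heq, hsum⟩ := truncated A q r hr
    have htp : 0 < t := by
      by_contra h
      have h0 : t = 0 := le_antisymm (not_lt.1 h) ht
      subst h0
      simp only [add_zero] at hge heq
      refine hno ⟨x, hx, hge, Finset.sum_eq_zero fun i _ => ?_⟩
      rcases (hx i).eq_or_lt with h | h
      · rw [← h, zero_mul]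
      · rw [heq i h, mul_zero]
    have hc : 0 < 1 / r := by positivity
    have hfac : ∀ i, q i * (1 / r) ^ (m + 1) + Axm1 A ((1 / r) • x) i + (1 / r) ^ (m + 1) * t
        = (1 / r) ^ (m + 1) * (q i + Axm1 A x i + t) := by
      intro i
      rw [Axm1_smul]; ring
    refine ⟨(1 / r) • x, (1 / r) ^ (m + 1) * t, fun i => mul_nonneg hc.le (hx i), ?_,
      by positivity, fun i => ?_, fun i => ?_⟩
    · simp only [Pi.smul_apply, smul_eq_mul]
      rw [← Finset.mul_sum, hsum htp]
      field_simp
    · rw [hfac]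
      exact mul_nonneg (by positivity) (hge i)
    · rw [hfac]
      rcases (hx i).eq_or_lt with h | h
      · simp [← h]
      · rw [heq i h]; simp
  choose y s hy hy1 hs hge hcomp using step
  obtain ⟨w, hw, φ, hφ, hlim⟩ := (isCompact_stdSimplex ℝ (Fin n)).tendsto_subseq
    (x := y) (fun k => ⟨hy k, hy1 k⟩)
  have hcont : ∀ i, Continuous (fun x => Axm1 A x i) := fun i => (Axm1_contDiff A i).continuous
  have heps : Filter.Tendsto (fun k => (1 / ((φ k : ℝ) + 1)) ^ (m + 1)) Filter.atTop (nhds 0) := by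
    have := ((tendsto_one_div_add_atTop_nhds_zero_nat (𝕜 := ℝ)).comp hφ.tendsto_atTop).pow (m + 1)
    simpa using this
  have hyi : ∀ i, Filter.Tendsto (fun k => y (φ k) i) Filter.atTop (nhds (w i)) :=
    fun i => (tendsto_pi_nhds.1 hlim) i
  have hF : ∀ i, Filter.Tendsto (fun k => q i * (1 / ((φ k : ℝ) + 1)) ^ (m + 1)
      + Axm1 A (y (φ k)) i) Filter.atTop (nhds (Axm1 A w i)) := by
    intro i
    have := (heps.const_mul (q i)).add (((hcont i).tendsto w).comp hlim)
    simpa using this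
  have hseq : ∀ k, s k = -∑ i, y k i * (q i * (1 / ((k : ℝ) + 1)) ^ (m + 1) + Axm1 A (y k) i) := by
    intro k
    have h0 := Finset.sum_eq_zero (s := Finset.univ) fun i _ => hcomp k i
    simp only [mul_add _ (_ + _) (s k)] at h0
    rw [Finset.sum_add_distrib, ← Finset.sum_mul, hy1 k] at h0
    linarith
  let σ : ℝ := -∑ i, w i * Axm1 A w i
  have hσ : Filter.Tendsto (fun k => s (φ k)) Filter.atTop (nhds σ) := by
    simp_rw [hseq]
    exact (tendsto_finset_sum _ fun i _ => (hyi i).mul (hF i)).neg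
  apply hA
  refine ⟨w, σ, hw.1, ?_, ge_of_tendsto' hσ fun k => hs _, ?_, ?_⟩
  · rintro rfl
    have := hw.2
    simp at this
  · intro i hi
    have h1 := (hyi i).mul ((hF i).add hσ)
    simp only [hcomp] at h1
    have h2 := tendsto_nhds_unique h1 tendsto_const_nhds
    exact (mul_eq_zero.1 h2).resolve_left hi.ne'
  · intro j _
    exact ge_of_tendsto' ((hF j).add hσ) fun k => hge _ _
end

section
/- Let A be a nonnegative m-th order n-dimensional tensor (all entries a_{i₁...i_m} ≥ 0). Then A is a Q-tensor if and only if all its principal diagonal entries a_{ii...i} are positive. -/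
open Finset

/-- Scarf dominance of a finite set with respect to a family of rankings. -/
def ScDom {I U : Type*} (r : I → U → ℕ) (X : Finset U) : Prop :=
  ∀ y, ∃ i, ∀ s ∈ X, r i y ≤ r i s

theorem ScDom.mono {I U : Type*} {r : I → U → ℕ} {X Y : Finset U} (h : ScDom r Y)
    (hXY : X ⊆ Y) : ScDom r X := by
  intro y
  obtain ⟨i, hi⟩ := h y
  exact ⟨i, fun s hs => hi s (hXY hs)⟩

/-- an inner door lies in exactly two rooms -/
theorem sc_inner {I U : Type*} [Fintype I] [DecidableEq I] [Fintype U] [DecidableEq U]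
    (r : I → U → ℕ) (hr : ∀ i, Function.Injective (r i)) (s : I → U)
    (hs2 : ∀ i j t, j ≠ i → t ∉ Set.range s → r i t < r i (s j))
    (X : Finset U) (hX : ScDom r X) (hc : X.card + 1 = Fintype.card I)
    (t : U) (ht : t ∈ X) (hts : t ∉ Set.range s) :
    ∃ x₁ x₂, x₁ ≠ x₂ ∧ x₁ ∉ X ∧ x₂ ∉ X ∧
      ∀ x, x ∉ X → (ScDom r (insert x X) ↔ x = x₁ ∨ x = x₂) := by
  have hmin : ∀ i, ∃ u ∈ X, ∀ v ∈ X, r i u ≤ r i v := fun i =>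
    X.exists_min_image (r i) ⟨t, ht⟩
  choose μ hμX hμ using hmin
  have hsurj : ∀ x ∈ X, ∃ i, μ i = x := by
    intro x hx
    obtain ⟨i, hi⟩ := hX x
    exact ⟨i, hr i (le_antisymm (hμ i x hx) (hi _ (hμX i)))⟩
  obtain ⟨i, -, j, -, hij, hμij⟩ : ∃ i ∈ (univ : Finset I), ∃ j ∈ (univ : Finset I),
      i ≠ j ∧ μ i = μ j := by
    apply Finset.exists_ne_map_eq_of_card_lt_of_maps_to (t := X)
    · rw [Finset.card_univ]; omega
    · intro a _; exact hμX a
  -- injectivity away from `j` or `i`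
  have hinj : ∀ i j : I, i ≠ j → μ i = μ j → Set.InjOn μ ((univ : Finset I).erase j) := by
    intro i j hij hμij
    apply Finset.injOn_of_card_image_eq
    have : ((univ : Finset I).erase j).image μ = X := by
      ext x
      simp only [Finset.mem_image, Finset.mem_erase, Finset.mem_univ, and_true]
      constructor
      · rintro ⟨a, _, rfl⟩; exact hμX a
      · intro hx
        obtain ⟨a, rfl⟩ := hsurj x hx
        by_cases ha : a = j
        · exact ⟨i, hij, by rw [ha, hμij]⟩
        · exact ⟨a, ha, rfl⟩
    rw [this, Finset.card_erase_of_mem (Finset.mem_univ _), Finset.card_univ]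
    omega
  -- best element for k
  have hbest : ∀ k, ∃ x, (∀ h, h ≠ k → r h (μ h) < r h x) ∧
      ∀ y, (∀ h, h ≠ k → r h (μ h) < r h y) → r k y ≤ r k x := by
    intro k
    obtain ⟨x, hx, hx'⟩ := ((univ : Finset U).filter
      (fun x => ∀ h, h ≠ k → r h (μ h) < r h x)).exists_max_image (r k) ⟨s k, by
        simp only [Finset.mem_filter, Finset.mem_univ, true_and]
        intro h hh
        exact lt_of_le_of_lt (hμ h t ht) (hs2 h k t (Ne.symm hh) hts)⟩
    simp only [Finset.mem_filter, Finset.mem_univ, true_and] at hx hx'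
    exact ⟨x, hx, hx'⟩
  choose b hb hbmax using hbest
  have hbk : ∀ k, r k (b k) ≤ r k (μ k) := by
    intro k
    obtain ⟨h, hh⟩ := hX (b k)
    by_cases hk : h = k
    · subst hk; exact hh _ (hμX _)
    · exact absurd (hh _ (hμX h)) (not_le.2 (hb k h hk))
  have hbX : ∀ k k', k ≠ k' → μ k = μ k' → b k ∉ X := by
    intro k k' hkk hμk hmem
    obtain ⟨h, hh⟩ := hsurj _ hmem
    have h1 : h = k := by
      by_contra hne
      have := hb k h hne
      rw [hh] at this
      exact lt_irrefl _ this
    have := hb k k' (Ne.symm hkk)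
    rw [← hμk, ← h1, hh] at this
    rw [h1] at this
    exact lt_irrefl _ this
  have hbdom : ∀ k, ScDom r (insert (b k) X) := by
    intro k y
    by_contra hcon
    push Not at hcon
    have hy : ∀ h, h ≠ k → r h (μ h) < r h y := by
      intro h hh
      obtain ⟨v, hv, hvy⟩ := hcon h
      rcases Finset.mem_insert.1 hv with rfl | hv
      · exact (hb k h hh).trans hvy
      · exact lt_of_le_of_lt (hμ h v hv) hvy
    have hy2 := hbmax k y hy
    obtain ⟨v, hv, hvy⟩ := hcon k
    rcases Finset.mem_insert.1 hv with rfl | hv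
    · exact absurd hvy (not_lt.2 hy2)
    · have := hbk k
      have := hμ k v hv
      omega
  refine ⟨b i, b j, ?_, hbX i j hij hμij, hbX j i hij.symm hμij.symm, ?_⟩
  · intro heq
    have h1 := hb i j hij.symm
    have h2 := hbk j
    rw [heq] at h1
    omega
  intro x hx
  constructor
  swap
  · rintro (rfl | rfl)
    · exact hbdom i
    · exact hbdom j
  intro hd
  -- each element of the room is a minimum
  have hall : ∀ z : {z // z ∈ insert x X}, ∃ h, ∀ v ∈ insert x X, r h z ≤ r h v := fun z => hd z
  choose g hg using hall
  have hginj : Function.Injective g := by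
    intro z w hzw
    apply Subtype.ext
    apply hr (g z)
    apply le_antisymm (hg z w w.2)
    rw [hzw]; exact hg w z z.2
  have hgsurj : Function.Surjective g := by
    have : Function.Bijective g := by
      rw [Fintype.bijective_iff_injective_and_card]
      refine ⟨hginj, ?_⟩
      rw [Fintype.card_coe, Finset.card_insert_of_notMem hx, hc]
    exact this.2
  set k := g ⟨x, Finset.mem_insert_self _ _⟩ with hk
  have hother : ∀ h, h ≠ k → r h (μ h) < r h x := by
    intro h hh
    obtain ⟨z, hz⟩ := hgsurj h
    have hzx : z.1 ≠ x := by
      intro he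
      apply hh
      rw [← hz, hk]
      congr 1
      exact Subtype.ext he
    have hzX : z.1 ∈ X := (Finset.mem_insert.1 z.2).resolve_left hzx
    have h1 := hg z x (Finset.mem_insert_self _ _)
    rw [hz] at h1
    have h2 : r h z ≠ r h x := fun he => hzx (hr h he)
    have h3 := hμ h z hzX
    omega
  have hxk : r k x < r k (μ k) := by
    have h1 := hg ⟨x, Finset.mem_insert_self _ _⟩ (μ k) (Finset.mem_insert_of_mem (hμX k))
    rw [← hk] at h1
    have h2 : r k x ≠ r k (μ k) := by
      intro he
      apply hx
      rw [hr k he]; exact hμX k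
    simp only at h1
    omega
  have hxb : x = b k := by
    apply hr k
    apply le_antisymm (hbmax k x hother)
    by_contra hlt
    push Not at hlt
    obtain ⟨h, hh⟩ := hd (b k)
    by_cases hhk : h = k
    · subst hhk
      exact absurd (hh x (Finset.mem_insert_self _ _)) (not_le.2 hlt)
    · exact absurd (hh _ (Finset.mem_insert_of_mem (hμX h))) (not_le.2 (hb k h hhk))
  have hkij : k = i ∨ k = j := by
    by_contra hne
    push Not at hne
    obtain ⟨z, hz⟩ := hgsurj i
    obtain ⟨w, hw⟩ := hgsurj j
    have key : ∀ (h : I) (z : {z // z ∈ insert x X}), g z = h → h ≠ k → z.1 = μ h := by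
      intro h z hz hh
      have h1 := hg z (μ h) (Finset.mem_insert_of_mem (hμX h))
      rw [hz] at h1
      have h0 := hg z x (Finset.mem_insert_self _ _)
      have hzx : z.1 ≠ x := by
        intro he
        apply hh
        rw [← hz, hk]
        congr 1
        exact Subtype.ext he
      have hzX : z.1 ∈ X := (Finset.mem_insert.1 z.2).resolve_left hzx
      exact hr h (le_antisymm h1 (hμ h z hzX))
    have e1 := key i z hz (Ne.symm hne.1)
    have e2 := key j w hw (Ne.symm hne.2)
    have : z = w := Subtype.ext (by rw [e1, e2, hμij])
    exact hij (by rw [← hz, ← hw, this])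
  rcases hkij with h | h
  · left; rw [hxb, h]
  · right; rw [hxb, h]

/-- the outer door lies in exactly one room -/
theorem sc_outer {I U : Type*} [Fintype I] [DecidableEq I] [Fintype U] [DecidableEq U]
    (r : I → U → ℕ) (hr : ∀ i, Function.Injective (r i)) (s : I → U)
    (hs1 : ∀ i t, r i (s i) ≤ r i t)
    (hs2 : ∀ i j t, j ≠ i → t ∉ Set.range s → r i t < r i (s j))
    (t : U) (hts : t ∉ Set.range s) (k : I) :
    ∃ x₁, x₁ ∉ ((univ : Finset I).erase k).image s ∧
      ∀ x, x ∉ ((univ : Finset I).erase k).image s →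
      (ScDom r (insert x (((univ : Finset I).erase k).image s)) ↔ x = x₁) := by
  classical
  obtain ⟨x₁, hx, hx'⟩ := ((univ : Finset U).filter
      (fun x => x ∉ Set.range s)).exists_max_image (r k) ⟨t, by simpa using hts⟩
  simp only [Finset.mem_filter, Finset.mem_univ, true_and] at hx hx'
  have hslt : ∀ h y, y ∉ Set.range s → r h (s h) < r h y := by
    intro h y hy
    refine lt_of_le_of_ne (hs1 h y) ?_
    intro he
    exact hy ⟨h, hr h he⟩
  refine ⟨x₁, ?_, ?_⟩
  · intro hm
    obtain ⟨a, -, rfl⟩ := Finset.mem_image.1 hm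
    exact hx ⟨a, rfl⟩
  intro x hxX
  constructor
  · intro hd
    have key : ∀ y, y ∉ Set.range s → r k y ≤ r k x := by
      intro y hy
      obtain ⟨h, hh⟩ := hd y
      by_cases hhk : h = k
      · subst hhk; exact hh x (Finset.mem_insert_self _ _)
      · have := hh (s h) (Finset.mem_insert_of_mem (Finset.mem_image_of_mem _ (by simp [hhk])))
        exact absurd this (not_le.2 (hslt h y hy))
    have hxs : x ∉ Set.range s := by
      rintro ⟨a, rfl⟩
      by_cases ha : a = k
      · subst ha
        exact absurd (key t hts) (not_le.2 (hslt _ t hts))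
      · exact hxX (Finset.mem_image_of_mem _ (by simp [ha]))
    exact hr k (le_antisymm (hx' x hxs) (key x₁ hx))
  · rintro rfl y
    by_cases hy : y ∈ Set.range s
    · obtain ⟨l, rfl⟩ := hy
      exact ⟨l, fun v _ => hs1 l v⟩
    · refine ⟨k, fun v hv => ?_⟩
      rcases Finset.mem_insert.1 hv with rfl | hv
      · exact hx' y hy
      · obtain ⟨a, ha, rfl⟩ := Finset.mem_image.1 hv
        exact (hs2 k a y (Finset.mem_erase.1 ha).1 hy).le

theorem sc_main {I U : Type*} [Fintype I] [DecidableEq I] [Fintype U] [DecidableEq U]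
    (r : I → U → ℕ) (hr : ∀ i, Function.Injective (r i)) (s : I → U)
    (hs1 : ∀ i t, r i (s i) ≤ r i t)
    (hs2 : ∀ i j t, j ≠ i → t ∉ Set.range s → r i t < r i (s j))
    (t : U) (hts : t ∉ Set.range s) (k : I)
    (c : U → I) (hcs : ∀ i, c (s i) = i) :
    ∃ R : Finset U, ScDom r R ∧ R.card = Fintype.card I ∧ R.image c = univ := by
  classical
  by_contra hcon
  push Not at hcon
  let D : Finset (Finset U) := univ.filter
    (fun X => ScDom r X ∧ X.card + 1 = Fintype.card I ∧ X.image c = univ.erase k)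
  let Q : Finset (Finset U) := univ.filter (fun X => ScDom r X ∧ X.card = Fintype.card I)
  have hsum := Finset.sum_card_bipartiteAbove_eq_sum_card_bipartiteBelow
    (s := D) (t := Q) (fun X R => X ⊆ R)
  have hI : 1 ≤ Fintype.card I := Fintype.card_pos_iff.2 ⟨k⟩
  -- rooms over X are inserts
  have hroom : ∀ X ∈ D, ∀ R, R ∈ Q.filter (fun R => X ⊆ R) ↔
      ∃ x, x ∉ X ∧ ScDom r (insert x X) ∧ R = insert x X := by
    intro X hX R
    simp only [D, Q, Finset.mem_filter, Finset.mem_univ, true_and] at hX ⊢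
    constructor
    · rintro ⟨⟨h1, h2⟩, h3⟩
      have : (R \ X).card = 1 := by
        rw [Finset.card_sdiff_of_subset h3]; omega
      obtain ⟨x, hx⟩ := Finset.card_eq_one.1 this
      have hxm : x ∈ R \ X := by rw [hx]; simp
      have hR : R = insert x X := by
        rw [Finset.insert_eq, ← hx, Finset.sdiff_union_of_subset h3]
      exact ⟨x, (Finset.mem_sdiff.1 hxm).2, hR ▸ h1, hR⟩
    · rintro ⟨x, hx, hd, rfl⟩
      refine ⟨⟨hd, ?_⟩, Finset.subset_insert _ _⟩
      rw [Finset.card_insert_of_notMem hx]; exact hX.2.1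
  set O : Finset U := ((univ : Finset I).erase k).image s with hO
  have hsinj : Function.Injective s := fun a b hab => by rw [← hcs a, hab, hcs b]
  have hOD : O ∈ D := by
    simp only [D, Finset.mem_filter, Finset.mem_univ, true_and]
    refine ⟨?_, ?_, ?_⟩
    · obtain ⟨x₁, h1, h2⟩ := sc_outer r hr s hs1 hs2 t hts k
      exact ((h2 x₁ h1).2 rfl).mono (Finset.subset_insert _ _)
    · rw [hO, Finset.card_image_of_injective _ hsinj,
        Finset.card_erase_of_mem (Finset.mem_univ _), Finset.card_univ]
      omega
    · rw [hO, Finset.image_image]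
      have : c ∘ s = id := funext hcs
      rw [this, Finset.image_id]
  have hin : ∀ X ∈ D, X ≠ O → (Q.filter (fun R => X ⊆ R)).card = 2 := by
    intro X hX hne
    have hX' := hX
    simp only [D, Finset.mem_filter, Finset.mem_univ, true_and] at hX'
    obtain ⟨h1, h2, h3⟩ := hX'
    have : ∃ u ∈ X, u ∉ Set.range s := by
      by_contra hall
      push Not at hall
      apply hne
      ext u
      constructor
      · intro hu
        obtain ⟨a, rfl⟩ := hall u hu
        apply Finset.mem_image_of_mem
        rw [← h3]
        rw [← hcs a]
        simpa [hcs] using Finset.mem_image_of_mem c hu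
      · intro hu
        obtain ⟨a, ha, rfl⟩ := Finset.mem_image.1 hu
        rw [← h3] at ha
        obtain ⟨v, hv, rfl⟩ := Finset.mem_image.1 ha
        obtain ⟨a, rfl⟩ := hall v hv
        rwa [hcs]
    obtain ⟨u, huX, hus⟩ := this
    obtain ⟨x₁, x₂, hne12, hx1, hx2, hiff⟩ := sc_inner r hr s hs2 X h1 h2 u huX hus
    rw [Finset.card_eq_two]
    refine ⟨insert x₁ X, insert x₂ X, ?_, ?_⟩
    · intro he
      have : x₁ ∈ insert x₂ X := he ▸ Finset.mem_insert_self _ _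
      rcases Finset.mem_insert.1 this with h | h
      · exact hne12 h
      · exact hx1 h
    · ext R
      rw [hroom X hX]
      simp only [Finset.mem_insert, Finset.mem_singleton]
      constructor
      · rintro ⟨x, hx, hd, rfl⟩
        rcases (hiff x hx).1 hd with rfl | rfl
        · exact Or.inl rfl
        · exact Or.inr rfl
      · rintro (rfl | rfl)
        · exact ⟨x₁, hx1, (hiff x₁ hx1).2 (Or.inl rfl), rfl⟩
        · exact ⟨x₂, hx2, (hiff x₂ hx2).2 (Or.inr rfl), rfl⟩
  have hout : (Q.filter (fun R => O ⊆ R)).card = 1 := by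
    obtain ⟨x₁, hx1, hiff⟩ := sc_outer r hr s hs1 hs2 t hts k
    rw [Finset.card_eq_one]
    refine ⟨insert x₁ O, ?_⟩
    ext R
    rw [hroom O hOD]
    simp only [Finset.mem_singleton]
    constructor
    · rintro ⟨x, hx, hd, rfl⟩
      rw [(hiff x hx).1 hd]
    · rintro rfl
      exact ⟨x₁, hx1, (hiff x₁ hx1).2 rfl, rfl⟩
  have hev : ∀ R ∈ Q, Even (D.filter (fun X => X ⊆ R)).card := by
    intro R hR
    by_cases hem : D.filter (fun X => X ⊆ R) = ∅
    · rw [hem]; simp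
    obtain ⟨X, hX⟩ := Finset.nonempty_iff_ne_empty.2 hem
    obtain ⟨hXD, hXR⟩ := Finset.mem_filter.1 hX
    obtain ⟨x, hx, hd, rfl⟩ := (hroom X hXD R).1 (Finset.mem_filter.2 ⟨hR, hXR⟩)
    have hXD' := hXD
    simp only [D, Finset.mem_filter, Finset.mem_univ, true_and] at hXD'
    obtain ⟨h1, h2, h3⟩ := hXD'
    simp only [Q, Finset.mem_filter, Finset.mem_univ, true_and] at hR
    have hcx : c x ≠ k := by
      intro he
      apply hcon _ hR.1 hR.2
      rw [Finset.image_insert, h3, he, Finset.insert_erase (Finset.mem_univ _)]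
    have hcinj : Set.InjOn c X := by
      apply Finset.injOn_of_card_image_eq
      rw [h3, Finset.card_erase_of_mem (Finset.mem_univ _), Finset.card_univ]
      omega
    have : c x ∈ X.image c := by rw [h3]; simp [hcx]
    obtain ⟨x', hx', hcx'⟩ := Finset.mem_image.1 this
    have hxx' : x' ≠ x := fun he => hx (he ▸ hx')
    have : (D.filter (fun Y => Y ⊆ insert x X)).card = 2 := by
      rw [Finset.card_eq_two]
      refine ⟨X, (insert x X).erase x', ?_, ?_⟩
      · intro he
        rw [he] at hx'
        exact (Finset.notMem_erase _ _) hx'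
      · ext Y
        simp only [D, Finset.mem_filter, Finset.mem_univ, true_and, Finset.mem_insert,
          Finset.mem_singleton]
        constructor
        · rintro ⟨⟨g1, g2, g3⟩, g4⟩
          have : (insert x X \ Y).card = 1 := by
            rw [Finset.card_sdiff_of_subset g4, hR.2]; omega
          obtain ⟨w, hw⟩ := Finset.card_eq_one.1 this
          have hY : Y = (insert x X).erase w := by
            rw [← Finset.sdiff_singleton_eq_erase, ← hw, Finset.sdiff_sdiff_eq_self g4]
          have hwm : w ∈ insert x X \ Y := by rw [hw]; simp
          have hwm := (Finset.mem_sdiff.1 hwm).1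
          by_cases hwx : w = x
          · left; rw [hY, hwx, Finset.erase_insert hx]
          · right
            have hwX : w ∈ X := (Finset.mem_insert.1 hwm).resolve_left hwx
            have hcw : c w ∈ Y.image c := by
              rw [g3, ← h3]; exact Finset.mem_image_of_mem c hwX
            obtain ⟨v, hv, hvw⟩ := Finset.mem_image.1 hcw
            rw [hY, Finset.mem_erase] at hv
            have hvx : v = x := by
              by_contra hvx
              have hvX : v ∈ X := (Finset.mem_insert.1 hv.2).resolve_left hvx
              exact hv.1 (hcinj hvX hwX hvw)
            have : w = x' := hcinj hwX hx' (by rw [hcx', ← hvw, hvx])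
            rw [hY, this]
        · rintro (rfl | rfl)
          · exact ⟨⟨h1, h2, h3⟩, Finset.subset_insert _ _⟩
          · refine ⟨⟨hd.mono (Finset.erase_subset _ _), ?_, ?_⟩, Finset.erase_subset _ _⟩
            · rw [Finset.card_erase_of_mem (Finset.mem_insert_of_mem hx'), hR.2]
              omega
            · rw [← h3]
              ext a
              simp only [Finset.mem_image, Finset.mem_erase, Finset.mem_insert]
              constructor
              · rintro ⟨v, ⟨_, rfl | hv⟩, rfl⟩
                · exact ⟨x', hx', hcx'⟩
                · exact ⟨v, hv, rfl⟩
              · rintro ⟨v, hv, rfl⟩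
                by_cases hvx : v = x'
                · exact ⟨x, ⟨hxx'.symm, Or.inl rfl⟩, by rw [hvx, hcx']⟩
                · exact ⟨v, ⟨hvx, Or.inr hv⟩, rfl⟩
    rw [this]; exact even_two
  have hR : Even (∑ R ∈ Q, (D.filter (fun X => X ⊆ R)).card) := Finset.even_sum _ hev
  have hL : ∑ X ∈ D, (Q.filter (fun R => X ⊆ R)).card = 1 + ∑ X ∈ D.erase O, 2 := by
    rw [← Finset.add_sum_erase _ _ hOD, hout]
    congr 1
    apply Finset.sum_congr rfl
    intro X hX
    exact hin X (Finset.mem_of_mem_erase hX) (Finset.ne_of_mem_erase hX)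
  have hsum' : ∑ X ∈ D, (Q.filter (fun R => X ⊆ R)).card
      = ∑ R ∈ Q, (D.filter (fun X => X ⊆ R)).card := hsum
  rw [← hsum', hL, Finset.sum_const, smul_eq_mul] at hR
  rcases hR with ⟨a, ha⟩
  omega

/-- approximate solutions on the grid of mesh `1 / N` -/
theorem sc_grid {I : Type*} [Fintype I] [DecidableEq I] [Nonempty I] (N : ℕ)
    (c : (I → ℕ) → I) :
    ∃ z : I → ℕ, ∑ i, z i = N ∧ ∀ i, Fintype.card I < z i →
      ∃ p : I → ℕ, ∑ i, p i = N ∧ c p = i ∧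
        ∀ h, p h ≤ z h + Fintype.card I ∧ z h ≤ p h + Fintype.card I := by
  classical
  let T := {z : I → ℕ // z ∈ Finset.piAntidiag (univ : Finset I) N}
  have hTsum : ∀ z : T, ∑ i, z.1 i = N := fun z => (Finset.mem_piAntidiag.1 z.2).1
  have hTle : ∀ (z : T) i, z.1 i ≤ N := fun z i => by
    exact (Finset.single_le_sum (f := z.1) (fun _ _ => Nat.zero_le _)
      (Finset.mem_univ i)).trans (hTsum z).le
  have mkT : ∀ z : I → ℕ, ∑ i, z i = N → z ∈ Finset.piAntidiag (univ : Finset I) N :=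
    fun z hz => Finset.mem_piAntidiag.2 ⟨hz, fun i _ => Finset.mem_univ i⟩
  obtain ⟨i₀⟩ := ‹Nonempty I›
  let t₀ : T := ⟨Pi.single i₀ N, mkT _ (by simp)⟩
  let K := Fintype.card T
  let e : T ≃ Fin K := Fintype.equivFin T
  let f : I ≃ Fin (Fintype.card I) := Fintype.equivFin I
  let r : I → T ⊕ I → ℕ := fun i u => Sum.elim (fun t : T => t.1 i * K + (e t : ℕ) + 1)
    (fun j => if j = i then 0 else (N + 1) * K + 1 + (f j : ℕ)) u
  have rl : ∀ i (t : T), r i (Sum.inl t) = t.1 i * K + (e t : ℕ) + 1 := fun _ _ => rfl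
  have rr : ∀ i j, r i (Sum.inr j) = if j = i then 0 else (N + 1) * K + 1 + (f j : ℕ) :=
    fun _ _ => rfl
  have hlt : ∀ i (t : T), r i (Sum.inl t) < (N + 1) * K + 1 := by
    intro i t
    rw [rl]
    have h1 := (e t).2
    have h2 : t.1 i * K ≤ N * K := Nat.mul_le_mul_right _ (hTle t i)
    rw [Nat.add_mul, one_mul]
    omega
  have hcmp : ∀ i (t t' : T), r i (Sum.inl t) ≤ r i (Sum.inl t') → t.1 i ≤ t'.1 i := by
    intro i t t' h
    rw [rl, rl] at h
    by_contra hcon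
    push Not at hcon
    have h1 : (t'.1 i + 1) * K ≤ t.1 i * K := Nat.mul_le_mul_right _ hcon
    rw [Nat.add_mul, one_mul] at h1
    have := (e t').2
    omega
  have hr : ∀ i, Function.Injective (r i) := by
    intro i u v huv
    rcases u with t | j <;> rcases v with t' | j'
    · have h1 := le_antisymm (hcmp i t t' huv.le) (hcmp i t' t huv.ge)
      rw [rl, rl, h1] at huv
      have : e t = e t' := Fin.ext (by omega)
      rw [e.injective this]
    · exfalso
      have h1 := hlt i t
      rw [huv, rr] at h1
      rw [rl, rr] at huv
      split_ifs at * <;> omega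
    · exfalso
      have h1 := hlt i t'
      rw [← huv, rr] at h1
      rw [rl, rr] at huv
      split_ifs at * <;> omega
    · rw [rr, rr] at huv
      split_ifs at huv with h1 h2 h2
      · rw [h1, h2]
      · omega
      · omega
      · have : f j = f j' := Fin.ext (by omega)
        rw [f.injective this]
  have hs1 : ∀ i t, r i (Sum.inr i) ≤ r i t := by
    intro i t
    rw [rr, if_pos rfl]; exact Nat.zero_le _
  have hs2 : ∀ i j t, j ≠ i → t ∉ Set.range (Sum.inr : I → T ⊕ I) →
      r i t < r i (Sum.inr j) := by
    intro i j t hji ht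
    rcases t with t | a
    · have := hlt i t
      rw [rr, if_neg hji]; omega
    · exact absurd ⟨a, rfl⟩ ht
  obtain ⟨R, hd, -, hcol⟩ := sc_main r hr Sum.inr hs1 hs2 (Sum.inl t₀) (by simp) i₀
    (Sum.elim (fun t : T => c t.1) id) (fun i => rfl)
  -- dominance restricted to grid points
  have hdom : ∀ y : T, ∃ i, Sum.inr i ∉ R ∧ ∀ p : T, Sum.inl p ∈ R → y.1 i ≤ p.1 i := by
    intro y
    obtain ⟨i, hi⟩ := hd (Sum.inl y)
    refine ⟨i, fun hm => ?_, fun p hp => hcmp i y p (hi _ hp)⟩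
    have := hi _ hm
    rw [rl, rr, if_pos rfl] at this
    omega
  have hcolor : ∀ i, Sum.inr i ∉ R → ∃ p : T, Sum.inl p ∈ R ∧ c p.1 = i := by
    intro i hi
    have : i ∈ R.image (Sum.elim (fun t : T => c t.1) id) := by rw [hcol]; simp
    obtain ⟨v, hv, hvi⟩ := Finset.mem_image.1 this
    rcases v with p | j
    · exact ⟨p, hv, hvi⟩
    · have : j = i := hvi
      subst this
      exact absurd hv hi
  obtain ⟨i₁, hi₁, -⟩ := hdom t₀
  obtain ⟨z, hzR, -⟩ := hcolor i₁ hi₁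
  have hm : ∀ i, ∃ m : ℕ, (Sum.inr i ∈ R → m = 0) ∧ (∀ p : T, Sum.inl p ∈ R → m ≤ p.1 i) ∧
      (Sum.inr i ∉ R → ∃ p : T, Sum.inl p ∈ R ∧ p.1 i = m) := by
    intro i
    by_cases hi : Sum.inr i ∈ R
    · exact ⟨0, fun _ => rfl, fun _ _ => Nat.zero_le _, fun h => absurd hi h⟩
    · obtain ⟨p, hp, hp'⟩ := ((univ : Finset T).filter
        (fun p => Sum.inl p ∈ R)).exists_min_image (fun p => p.1 i) ⟨z, by simpa using hzR⟩
      simp only [Finset.mem_filter, Finset.mem_univ, true_and] at hp hp'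
      exact ⟨p.1 i, fun h => absurd h hi, hp', fun _ => ⟨p, hp, rfl⟩⟩
  choose m hm0 hmle hmex using hm
  have hbig : N < ∑ i, m i + Fintype.card I := by
    let y₀ : I → ℕ := fun i => if Sum.inr i ∈ R then 0 else m i + 1
    have hle : ∑ i, y₀ i ≤ ∑ i, m i + Fintype.card I := by
      have : ∑ i, (m i + 1) = ∑ i, m i + Fintype.card I := by
        rw [Finset.sum_add_distrib]; simp
      rw [← this]
      apply Finset.sum_le_sum
      intro i _
      simp only [y₀]
      split_ifs <;> omega
    by_contra hcon
    push Not at hcon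
    have hyN : ∑ i, y₀ i ≤ N := hle.trans hcon
    let y : T := ⟨y₀ + Pi.single i₁ (N - ∑ i, y₀ i), mkT _ (by
      simp only [Pi.add_apply, Finset.sum_add_distrib, Finset.sum_pi_single', Finset.mem_univ,
        if_true]
      omega)⟩
    obtain ⟨i, hi, hyi⟩ := hdom y
    obtain ⟨p, hp, hpm⟩ := hmex i hi
    have h1 := hyi p hp
    have h2 : y₀ i ≤ y.1 i := by simp [y]
    have h3 : y₀ i = m i + 1 := if_neg hi
    omega
  have hclose : ∀ p : T, Sum.inl p ∈ R → ∀ h, p.1 h ≤ m h + Fintype.card I := by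
    intro p hp h
    have h1 : ∑ i, p.1 i = N := hTsum p
    have h2 : ∑ i ∈ univ.erase h, m i ≤ ∑ i ∈ univ.erase h, p.1 i :=
      Finset.sum_le_sum fun i _ => hmle i p hp
    rw [← Finset.add_sum_erase _ _ (Finset.mem_univ h)] at h1 hbig
    omega
  refine ⟨z.1, hTsum z, fun i hi => ?_⟩
  have hiR : Sum.inr i ∉ R := by
    intro hmem
    have h1 := hm0 i hmem
    have h2 := hclose z hzR i
    omega
  obtain ⟨p, hp, hpc⟩ := hcolor i hiR
  refine ⟨p.1, hTsum p, hpc, fun h => ?_⟩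
  have h1 := hclose z hzR h
  have h2 := hclose p hp h
  have h3 := hmle h z hzR
  have h4 := hmle h p hp
  omega

open Filter Topology in
/-- complementarity on the standard simplex -/
theorem sc_simplex {I : Type*} [Fintype I] [DecidableEq I] [Nonempty I]
    (G : (I → ℝ) → I → ℝ) (hG : ∀ i, Continuous fun x => G x i) :
    ∃ x ∈ stdSimplex ℝ I, ∀ i, 0 < x i → ∀ h, G x i ≤ G x h := by
  classical
  have hcol : ∀ x : I → ℝ, ∃ i, ∀ h, G x i ≤ G x h := fun x => Finite.exists_min (G x)
  choose c hc using hcol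
  have hgrid := fun N : ℕ => sc_grid (N + 1) (fun z : I → ℕ => c (fun i => (z i : ℝ) / (N + 1 : ℕ)))
  choose z hz hz' using hgrid
  let X : ℕ → I → ℝ := fun N i => (z N i : ℝ) / (N + 1 : ℕ)
  have hX : ∀ N, X N ∈ stdSimplex ℝ I := by
    intro N
    refine ⟨fun i => by positivity, ?_⟩
    simp only [X]
    rw [← Finset.sum_div, ← Nat.cast_sum, hz]
    exact div_self (by positivity)
  obtain ⟨x, hx, φ, hφ, hlim⟩ := (isCompact_stdSimplex ℝ I).tendsto_subseq hX
  refine ⟨x, hx, fun i hi h => ?_⟩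
  have hex : ∀ N, ∃ P : I → ℝ, (Fintype.card I < z N i → G P i ≤ G P h) ∧
      ∀ l, |P l - X N l| ≤ (Fintype.card I : ℝ) / (N + 1 : ℕ) := by
    intro N
    by_cases hN : Fintype.card I < z N i
    · obtain ⟨p, _, hp2, hp3⟩ := hz' N i hN
      refine ⟨fun i => (p i : ℝ) / (N + 1 : ℕ), fun _ => ?_, fun l => ?_⟩
      · have := hc (fun i => (p i : ℝ) / (N + 1 : ℕ)) h
        rwa [hp2] at this
      · simp only [X]
        rw [← sub_div, abs_div, abs_of_pos (by positivity : (0:ℝ) < (N + 1 : ℕ))]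
        gcongr
        have h1 : (p l : ℝ) ≤ z N l + Fintype.card I := by exact_mod_cast (hp3 l).1
        have h2 : (z N l : ℝ) ≤ p l + Fintype.card I := by exact_mod_cast (hp3 l).2
        rw [abs_le]; constructor <;> linarith
    · exact ⟨X N, fun h => absurd h hN, fun l => by simp; positivity⟩
  choose P hP1 hP2 using hex
  have h0 : Tendsto (fun N : ℕ => (Fintype.card I : ℝ) / (N + 1 : ℕ)) atTop (𝓝 0) :=
    (tendsto_const_div_atTop_nhds_zero_nat (Fintype.card I : ℝ)).comp (tendsto_add_atTop_nat 1)
  have h0' := h0.comp hφ.tendsto_atTop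
  have hXl : ∀ l, Tendsto (fun N => X (φ N) l) atTop (𝓝 (x l)) := fun l =>
    (tendsto_pi_nhds.1 hlim) l
  have hPlim : Tendsto (fun N => P (φ N)) atTop (𝓝 x) := by
    rw [tendsto_pi_nhds]
    intro l
    have h1 : Tendsto (fun N => P (φ N) l - X (φ N) l) atTop (𝓝 0) :=
      squeeze_zero_norm (fun N => hP2 (φ N) l) h0'
    have := h1.add (hXl l)
    simpa using this
  have hev : ∀ᶠ N in atTop, G (P (φ N)) i ≤ G (P (φ N)) h := by
    have := h0'.eventually_lt (hXl i) hi
    filter_upwards [this] with N hN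
    apply hP1
    simp only [X, Function.comp] at hN
    rw [div_lt_div_iff_of_pos_right (by positivity)] at hN
    exact_mod_cast hN
  exact le_of_tendsto_of_tendsto (((hG i).tendsto x).comp hPlim)
    (((hG h).tendsto x).comp hPlim) hev

theorem stmt7 {m n : ℕ} (A : (Fin (m + 2) → Fin n) → ℝ)
    (hA : ∀ f, 0 ≤ A f) :
    QTensor A ↔ ∀ i : Fin n, 0 < A (fun _ => i) := by
  have hcons : ∀ i : Fin n, (Fin.cons i (fun _ => i) : Fin (m + 2) → Fin n) = fun _ => i := by
    intro i
    funext j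
    refine Fin.cases ?_ (fun j => ?_) j <;> simp
  have hnn : ∀ x : Fin n → ℝ, (∀ i, 0 ≤ x i) → ∀ i, 0 ≤ Axm1 A x i := fun x hx i =>
    Finset.sum_nonneg fun f _ => mul_nonneg (hA _) (Finset.prod_nonneg fun j _ => hx _)
  constructor
  · intro hQ k
    obtain ⟨x, hx, hF, hcomp⟩ := hQ (fun i => if i = k then -1 else 1)
    have hz : ∀ i, i ≠ k → x i = 0 := by
      intro i hi
      have h1 := (Finset.sum_eq_zero_iff_of_nonneg
        (fun j _ => mul_nonneg (hx j) (hF j))).1 hcomp i (Finset.mem_univ i)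
      have h2 := hnn x hx i
      rcases mul_eq_zero.1 h1 with h | h
      · exact h
      · simp only [if_neg hi] at h; linarith
    have h1 : Axm1 A x k = A (fun _ => k) * x k ^ (m + 1) := by
      unfold Axm1
      rw [Finset.sum_eq_single (fun _ => k)]
      · rw [hcons]; simp
      · intro f _ hf
        obtain ⟨j, hj⟩ := Function.ne_iff.1 hf
        rw [Finset.prod_eq_zero (Finset.mem_univ j) (hz _ hj), mul_zero]
      · intro h; exact absurd (Finset.mem_univ _) h
    have h2 := hF k
    simp only [if_true, h1] at h2
    refine lt_of_le_of_ne (hA _) fun h => ?_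
    rw [← h] at h2
    norm_num at h2
  · intro hpos q
    let ρ : ℝ := 1 + ∑ j, |q j| / A (fun _ => j)
    have hρt : ∀ j, |q j| / A (fun _ => j) ≤ ∑ j, |q j| / A (fun _ => j) := fun j =>
      Finset.single_le_sum (f := fun j => |q j| / A (fun _ => j))
        (fun i _ => div_nonneg (abs_nonneg _) (hA _)) (Finset.mem_univ j)
    have hρ1 : 1 ≤ ρ := by
      have : 0 ≤ ∑ j, |q j| / A (fun _ => j) :=
        Finset.sum_nonneg fun i _ => div_nonneg (abs_nonneg _) (hA _)
      simp only [ρ]; linarith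
    have hρq : ∀ j, |q j| < A (fun _ => j) * ρ := by
      intro j
      have h1 : |q j| / A (fun _ => j) < ρ := by
        have := hρt j
        simp only [ρ]; linarith
      rw [div_lt_iff₀ (hpos j)] at h1
      linarith
    let L : (Option (Fin n) → ℝ) → Fin n → ℝ := fun y i => (n * ρ) * y (some i)
    let G : (Option (Fin n) → ℝ) → Option (Fin n) → ℝ := fun y o =>
      Option.elim o 0 (fun i => q i + Axm1 A (L y) i)
    have hG : ∀ o, Continuous fun y => G y o := by
      intro o
      cases o with
      | none => exact continuous_const
      | some i =>
        show Continuous fun y => q i + Axm1 A (L y) i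
        unfold Axm1
        simp only [L]
        fun_prop
    obtain ⟨y, hy, hyG⟩ := sc_simplex G hG
    have hLnn : ∀ i, 0 ≤ L y i := fun i =>
      mul_nonneg (mul_nonneg (Nat.cast_nonneg _) (by linarith)) (hy.1 _)
    have hGn : G y none = 0 := rfl
    have hGs : ∀ i, G y (some i) = q i + Axm1 A (L y) i := fun _ => rfl
    have hy0 : 0 < y none := by
      by_contra hcon
      have h0 : y none = 0 := le_antisymm (not_lt.1 hcon) (hy.1 _)
      have hs := hy.2
      rw [Fintype.sum_option, h0, zero_add] at hs
      have hn : 0 < n := by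
        rcases Nat.eq_zero_or_pos n with rfl | h
        · simp at hs
        · exact h
      have hnR : (0 : ℝ) < n := by exact_mod_cast hn
      obtain ⟨i, -, hi⟩ : ∃ i ∈ (univ : Finset (Fin n)), (1 / n : ℝ) ≤ y (some i) := by
        apply Finset.exists_le_of_sum_le
        · exact ⟨⟨0, hn⟩, Finset.mem_univ _⟩
        · rw [hs]; simp [hnR.ne']
      have hLi : ρ ≤ L y i := by
        have : ρ = (n * ρ) * (1 / n : ℝ) := by field_simp
        rw [this]
        exact mul_le_mul_of_nonneg_left hi (by positivity)
      have h1 := hyG (some i) (lt_of_lt_of_le (by positivity) hi) none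
      rw [hGn, hGs] at h1
      have h2 : A (fun _ => i) * L y i ^ (m + 1) ≤ Axm1 A (L y) i := by
        have := Finset.single_le_sum (f := fun f : Fin (m + 1) → Fin n =>
          A (Fin.cons i f) * ∏ j, L y (f j))
          (fun f _ => mul_nonneg (hA _) (Finset.prod_nonneg fun j _ => hLnn _))
          (Finset.mem_univ (fun _ => i))
        simp only [hcons, Finset.prod_const, Finset.card_univ, Fintype.card_fin] at this
        exact this
      have h3 : ρ ≤ L y i ^ (m + 1) := hLi.trans (le_self_pow₀ (hρ1.trans hLi) (by omega))
      have h4 := mul_le_mul_of_nonneg_left h3 (hA (fun _ => i))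
      have h5 := hρq i
      have h6 := neg_abs_le (q i)
      linarith
    have hF : ∀ i, 0 ≤ q i + Axm1 A (L y) i := by
      intro i
      have := hyG none hy0 (some i)
      rwa [hGn, hGs] at this
    refine ⟨L y, hLnn, hF, Finset.sum_eq_zero fun i _ => ?_⟩
    rcases (hy.1 (some i)).eq_or_lt with h | h
    · have : L y i = 0 := by simp only [L]; rw [← h, mul_zero]
      rw [this, zero_mul]
    · have h1 := hyG (some i) h none
      rw [hGn, hGs] at h1
      rw [le_antisymm h1 (hF i), mul_zero]
end
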